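/- arXiv:2508.14638 — 5 statements merged into one kernel-verified Lean document; each statement's English description precedes it below -/
import Mathlib

section
/- Let G be a group and x ∈ G such that the image of x in the abelianization of G has infinite order and is primitive, and such that for every nonzero integer k the centralizer of x^k in G is cyclic (i.e., equals ⟨c⟩ for some c ∈ G). Then for every nonzero integer k the centralizer of x^k in G equals ⟨x⟩. -/
/-- Let `G` be a group and `x ∈ G` such that the image of `x` in the
abelianization of `G` has infinite order and is primitive, and such that for every nonzero
integer `k` the centralizer of `x^k` in `G` is cyclic (equals `⟨c⟩` for some `c ∈ G`).  Then for
every nonzero integer `k` the centralizer of `x^k` equals `⟨x⟩`. -/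
theorem centralizer_zpow_eq_zpowers_of_primitive_of_cyclic_centralizer
    {G : Type*} [Group G] (x : G)
    (hinf : ¬ IsOfFinOrder (Abelianization.of x))
    (hprim : ∀ (b : Abelianization G) (k : ℤ), Abelianization.of x = b ^ k → k = 1 ∨ k = -1)
    (hcyc : ∀ k : ℤ, k ≠ 0 → ∃ c : G, Subgroup.centralizer {x ^ k} = Subgroup.zpowers c) :
    ∀ k : ℤ, k ≠ 0 → Subgroup.centralizer {x ^ k} = Subgroup.zpowers x := by
  intro k hk
  obtain ⟨c, hc⟩ := hcyc k hk
  have hx : x ∈ Subgroup.zpowers c := by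
    rw [← hc, Subgroup.mem_centralizer_singleton_iff]
    exact ((Commute.refl x).zpow_right k).eq
  obtain ⟨m, rfl⟩ := Subgroup.mem_zpowers_iff.mp hx
  rw [hc]
  rcases hprim (Abelianization.of c) m (map_zpow _ c m) with rfl | rfl
  · rw [zpow_one]
  · rw [zpow_neg_one, Subgroup.zpowers_inv]
end

section
/- Let G be a group and x ∈ G such that the image of x in the abelianization of G has infinite order, and such that for every nonzero integer k the centralizer of x^k in G equals ⟨x⟩. If an element g ∈ G fixes two distinct left cosets of ⟨x⟩ under the action by left multiplication (that is, g·c₁ = c₁ and g·c₂ = c₂ with c₁ ≠ c₂), then g = 1. -/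
/-- An element fixing the left coset `a⟨x⟩` is conjugate by `a` to a power of `x`. -/
theorem exists_eq_conj_zpow_of_smul_mk_eq {G : Type*} [Group G] {x g a : G}
    (h : g • (a : G ⧸ Subgroup.zpowers x) = a) : ∃ i : ℤ, g = a * x ^ i * a⁻¹ := by
  have hmem : a⁻¹ * (g * a) ∈ Subgroup.zpowers x := QuotientGroup.eq.mp h.symm
  obtain ⟨i, hi⟩ := Subgroup.mem_zpowers_iff.mp hmem
  exact ⟨i, by rw [hi]; group⟩

/-- If `x` has infinite order in the abelianization, conjugate powers of `x` have equal exponents. -/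
theorem zpow_exponent_eq_of_conj_eq {G : Type*} [Group G] {x a b : G} {i j : ℤ}
    (hinf : ¬ IsOfFinOrder (Abelianization.of x))
    (h : a * x ^ i * a⁻¹ = b * x ^ j * b⁻¹) : i = j := by
  have hab := congrArg Abelianization.of h
  simp only [map_mul, map_inv, map_zpow, mul_inv_cancel_comm] at hab
  exact injective_zpow_iff_not_isOfFinOrder.mpr hinf hab


/-- Let `G` be a group and `x ∈ G` such that the image of `x` in the
abelianization of `G` has infinite order, and such that for every nonzero integer `k` the
centralizer of `x^k` equals `⟨x⟩`.  If `g ∈ G` fixes two distinct left cosets of `⟨x⟩` under the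
action by left multiplication, then `g = 1`. -/
theorem eq_one_of_fixes_two_distinct_cosets
    {G : Type*} [Group G] (x : G)
    (hinf : ¬ IsOfFinOrder (Abelianization.of x))
    (hcent : ∀ k : ℤ, k ≠ 0 → Subgroup.centralizer {x ^ k} = Subgroup.zpowers x)
    (g : G) (c₁ c₂ : G ⧸ Subgroup.zpowers x) (hne : c₁ ≠ c₂)
    (h₁ : g • c₁ = c₁) (h₂ : g • c₂ = c₂) :
    g = 1 := by
  induction c₁ using QuotientGroup.induction_on with | H a
  induction c₂ using QuotientGroup.induction_on with | H b
  obtain ⟨i, hi⟩ := exists_eq_conj_zpow_of_smul_mk_eq h₁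
  obtain ⟨j, hj⟩ := exists_eq_conj_zpow_of_smul_mk_eq h₂
  obtain rfl := zpow_exponent_eq_of_conj_eq hinf (hi.symm.trans hj)
  by_cases hi0 : i = 0
  · simp [hi, hi0]
  refine absurd (QuotientGroup.eq.mpr ?_) hne
  rw [← hcent i hi0, Subgroup.mem_centralizer_singleton_iff]
  calc a⁻¹ * b * x ^ i = a⁻¹ * (b * x ^ i * b⁻¹) * b := by group
    _ = a⁻¹ * (a * x ^ i * a⁻¹) * b := by rw [← hj, hi]
    _ = x ^ i * (a⁻¹ * b) := by group
end

section
/- Let A ∈ SL(2,ℤ) with trace strictly greater than 2, and let G = ℤ² ⋊_A ℤ be the semidirect product in which the generator 1 ∈ ℤ acts on ℤ² by v ↦ Av, so that (v,m)(w,n) = (v + A^m w, m+n). Let x = (0,1) ∈ G. Then for every nonzero integer j, the centralizer of x^j in G equals ⟨x⟩ = {(0,m) : m ∈ ℤ}. -/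
/-- The automorphism of `Multiplicative ℤ²` induced by a matrix `A ∈ SL(2,ℤ)` acting on `ℤ²` by
matrix-vector multiplication. -/
noncomputable def sl2Aut (A : Matrix.SpecialLinearGroup (Fin 2) ℤ) :
    MulAut (Multiplicative (Fin 2 → ℤ)) :=
  AddEquiv.toMultiplicative (Matrix.SpecialLinearGroup.toLin' A).toAddEquiv

/-- The fundamental group of the torus bundle over `S¹` with monodromy `A ∈ SL(2,ℤ)`:
the semidirect product `ℤ² ⋊_A ℤ` in which the generator `1 ∈ ℤ` acts on `ℤ²` by `v ↦ Av`,
so that `(v, m) * (w, n) = (v + A^m w, m + n)`. -/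
noncomputable abbrev TorusBundleGroup (A : Matrix.SpecialLinearGroup (Fin 2) ℤ) : Type :=
  Multiplicative (Fin 2 → ℤ) ⋊[zpowersHom (MulAut (Multiplicative (Fin 2 → ℤ))) (sl2Aut A)]
    Multiplicative ℤ

/-- The element `x = (0, 1)` of `ℤ² ⋊_A ℤ`. -/
noncomputable def torusBundleSection (A : Matrix.SpecialLinearGroup (Fin 2) ℤ) :
    TorusBundleGroup A :=
  SemidirectProduct.inr (Multiplicative.ofAdd (1 : ℤ))

/-- The traces of the powers of a matrix in `SL(2,ℤ)` of trace greater than `2` are strictly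
increasing. -/
theorem two_le_trace_pow_and_trace_pow_lt_trace_pow_succ (A : Matrix (Fin 2) (Fin 2) ℤ)
    (hdet : A.det = 1) (htr : 2 < A.trace) (n : ℕ) :
    2 ≤ (A ^ n).trace ∧ (A ^ n).trace < (A ^ (n + 1)).trace := by
  induction n with
  | zero => simpa using htr
  | succ n ih =>
    have hrec : (A ^ (n + 2)).trace = A.trace * (A ^ (n + 1)).trace - (A ^ n).trace := by
      rw [pow_succ A (n + 1), pow_succ A n]
      generalize A ^ n = B
      rw [Matrix.det_fin_two] at hdet
      simp only [Matrix.trace_fin_two, Matrix.mul_apply, Fin.sum_univ_two]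
      linear_combination (B 0 0 + B 1 1) * (-hdet)
    refine ⟨by linarith, ?_⟩
    rw [hrec]
    nlinarith

/-- A matrix in `SL(2,ℤ)` of trace different from `2` fixes no nonzero vector. -/
theorem eq_zero_of_mulVec_eq_self_of_trace_ne_two (B : Matrix (Fin 2) (Fin 2) ℤ)
    (hdet : B.det = 1) (htr : B.trace ≠ 2) (v : Fin 2 → ℤ) (hv : B.mulVec v = v) : v = 0 := by
  refine Matrix.eq_zero_of_mulVec_eq_zero (M := B - 1) ?_ (by simp [Matrix.sub_mulVec, hv])
  rw [Matrix.det_fin_two] at hdet ⊢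
  rw [Matrix.trace_fin_two] at htr
  simp only [Matrix.sub_apply, Matrix.one_apply_eq, ne_eq, zero_ne_one, one_ne_zero,
    not_false_eq_true, Matrix.one_apply_ne]
  intro h
  exact htr (by linear_combination hdet - h)

theorem toAdd_sl2Aut_pow_apply (A : Matrix.SpecialLinearGroup (Fin 2) ℤ) (n : ℕ)
    (v : Multiplicative (Fin 2 → ℤ)) :
    ((sl2Aut A ^ n) v).toAdd =
      ((A : Matrix (Fin 2) (Fin 2) ℤ) ^ n).mulVec v.toAdd := by
  induction n with
  | zero => simp
  | succ n ih =>
    rw [pow_succ', pow_succ', ← Matrix.mulVec_mulVec, ← ih]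
    rfl

/-- No nonzero power of an Anosov automorphism of `ℤ²` fixes a nontrivial element. -/
theorem eq_one_of_sl2Aut_zpow_apply_eq_self (A : Matrix.SpecialLinearGroup (Fin 2) ℤ)
    (htr : 2 < Matrix.trace (A : Matrix (Fin 2) (Fin 2) ℤ)) {j : ℤ} (hj : j ≠ 0)
    {v : Multiplicative (Fin 2 → ℤ)} (hv : (sl2Aut A ^ j) v = v) : v = 1 := by
  have hpow : (sl2Aut A ^ j.natAbs) v = v := by
    rcases Int.natAbs_eq j with h | h
    · rw [h, zpow_natCast] at hv
      exact hv
    · rw [h, zpow_neg, zpow_natCast] at hv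
      nth_rewrite 1 [← hv]
      exact MulAut.apply_inv_self _ _ _
  obtain ⟨n, hn⟩ := Nat.exists_eq_succ_of_ne_zero (Int.natAbs_ne_zero.mpr hj)
  rw [hn] at hpow
  have hlt := two_le_trace_pow_and_trace_pow_lt_trace_pow_succ _ A.det_coe htr n
  have hfix := toAdd_sl2Aut_pow_apply A (n + 1) v
  rw [hpow] at hfix
  exact Multiplicative.toAdd.injective <|
    eq_zero_of_mulVec_eq_self_of_trace_ne_two _ (by simp [Matrix.det_pow])
      (hlt.1.trans_lt hlt.2).ne' _ hfix.symm

theorem torusBundleSection_zpow (A : Matrix.SpecialLinearGroup (Fin 2) ℤ) (j : ℤ) :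
    torusBundleSection A ^ j = SemidirectProduct.inr (Multiplicative.ofAdd j) := by
  rw [torusBundleSection, ← map_zpow, ← ofAdd_zsmul, smul_eq_mul, mul_one]

/-- Let `A ∈ SL(2,ℤ)` with trace strictly greater than `2`, let
`G = ℤ² ⋊_A ℤ`, and let `x = (0, 1) ∈ G`.  Then for every nonzero integer `j` the centralizer of
`x^j` in `G` equals `⟨x⟩ = {(0, m) : m ∈ ℤ}`. -/
theorem centralizer_zpow_section_eq_zpowers_of_anosov
    (A : Matrix.SpecialLinearGroup (Fin 2) ℤ)
    (htr : Matrix.trace (A : Matrix (Fin 2) (Fin 2) ℤ) > 2) :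
    ∀ j : ℤ, j ≠ 0 →
      Subgroup.centralizer {torusBundleSection A ^ j} =
        Subgroup.zpowers (torusBundleSection A) := by
  intro j hj
  refine le_antisymm (fun g hg => ?_) ?_
  · rw [Subgroup.mem_centralizer_singleton_iff, torusBundleSection_zpow] at hg
    have hleft : g.left = 1 := by
      refine eq_one_of_sl2Aut_zpow_apply_eq_self A htr hj ?_
      simpa [zpowersHom_apply] using (congrArg SemidirectProduct.left hg).symm
    refine Subgroup.mem_zpowers_iff.mpr ⟨g.right.toAdd, ?_⟩
    rw [torusBundleSection_zpow]
    ext1 <;> simp [hleft]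
  · rw [Subgroup.zpowers_le, Subgroup.mem_centralizer_singleton_iff]
    exact (Commute.refl (torusBundleSection A)).zpow_right j
end

section
/- Let A be a 2×2 integer matrix with determinant 1 and trace strictly greater than 2. Then there exists a linear (total) order on ℤ² that is invariant under translation (v ≤ w implies u + v ≤ u + w for all u) and preserved by A (v ≤ w implies Av ≤ Aw). -/
/-- The discriminant `t ^ 2 - 4` lies strictly between `(t - 1) ^ 2` and `t ^ 2` for `t > 2`. -/
theorem Int.not_isSquare_sq_sub_four {t : ℤ} (ht : 2 < t) : ¬ IsSquare (t ^ 2 - 4) := by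
  rintro ⟨s, hs⟩
  have h1 : |s| < t := abs_lt_of_sq_lt_sq (by nlinarith) (by lia)
  have h2 : t - 1 < |s| := lt_abs.2 <| by
    by_contra! h
    nlinarith
  lia

theorem irrational_sqrt_sq_sub_four {t : ℤ} (ht : 2 < t) :
    Irrational (√((t : ℝ) ^ 2 - 4)) := by
  have h : Irrational (√((t ^ 2 - 4 : ℤ) : ℝ)) :=
    irrational_sqrt_intCast_iff.2 ⟨Int.not_isSquare_sq_sub_four ht, by nlinarith⟩
  simpa using h

/-- An injective additive functional `f` into `ℝ` which `g` multiplies by a nonnegative scalar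
pulls the order of `ℝ` back to a translation-invariant linear order preserved by `g`. -/
theorem exists_isLinearOrder_of_injective_addMonoidHom {G : Type*} [AddCommGroup G]
    (f : G →+ ℝ) (hf : Function.Injective f) (g : G → G) {l : ℝ} (hl : 0 ≤ l)
    (hg : ∀ v, f (g v) = l * f v) :
    ∃ r : G → G → Prop, IsLinearOrder G r ∧
      (∀ u v w, r v w → r (u + v) (u + w)) ∧ ∀ v w, r v w → r (g v) (g w) := by
  refine ⟨fun v w => f v ≤ f w, ?_, fun u v w h => ?_, fun v w h => ?_⟩
  · exact
      { refl := fun _ => le_rfl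
        trans := fun _ _ _ => le_trans
        antisymm := fun _ _ h h' => hf (le_antisymm h h')
        total := fun _ _ => le_total _ _ }
  · simpa using h
  · simpa only [hg] using mul_le_mul_of_nonneg_left h hl

/-- Let `A` be a `2×2` integer matrix with determinant `1` and trace strictly
greater than `2`.  Then there exists a linear (total) order on `ℤ²` that is invariant under
translation and preserved by `A`. -/
theorem exists_translation_invariant_linear_order_preserved_by_anosov
    (A : Matrix (Fin 2) (Fin 2) ℤ) (hdet : A.det = 1) (htr : Matrix.trace A > 2) :
    ∃ r : (Fin 2 → ℤ) → (Fin 2 → ℤ) → Prop,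
      IsLinearOrder (Fin 2 → ℤ) r ∧
      (∀ u v w : Fin 2 → ℤ, r v w → r (u + v) (u + w)) ∧
      (∀ v w : Fin 2 → ℤ, r v w → r (A.mulVec v) (A.mulVec w)) := by
  have hirr := irrational_sqrt_sq_sub_four htr
  rw [Matrix.det_fin_two] at hdet
  rw [Matrix.trace_fin_two] at htr hirr
  have hc : A 1 0 ≠ 0 := by
    intro h
    rw [h, mul_zero, sub_zero] at hdet
    rcases Int.mul_eq_one_iff_eq_one_or_neg_one.1 hdet with h | h <;> lia
  have hdetR : (A 0 0 : ℝ) * A 1 1 - A 0 1 * A 1 0 = 1 := mod_cast hdet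
  have htrR : (2 : ℝ) < A 0 0 + A 1 1 := mod_cast htr
  push_cast at hirr
  have hs : √(((A 0 0 : ℝ) + A 1 1) ^ 2 - 4) ^ 2 = ((A 0 0 : ℝ) + A 1 1) ^ 2 - 4 :=
    Real.sq_sqrt (by nlinarith)
  have hs0 := Real.sqrt_nonneg (((A 0 0 : ℝ) + A 1 1) ^ 2 - 4)
  generalize √(((A 0 0 : ℝ) + A 1 1) ^ 2 - 4) = s at hirr hs hs0
  obtain ⟨l, hl⟩ : ∃ l : ℝ, l = (A 0 0 + A 1 1 + s) / 2 := ⟨_, rfl⟩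
  have hchar : l ^ 2 = (A 0 0 + A 1 1) * l - 1 := by
    rw [hl]
    linear_combination hs / 4
  let f : (Fin 2 → ℤ) →+ ℝ :=
    { toFun := fun v => A 1 0 * v 0 + (l - A 0 0) * v 1
      map_zero' := by simp
      map_add' := fun v w => by
        simp only [Pi.add_apply, Int.cast_add]
        ring }
  have hf (v : Fin 2 → ℤ) : f v = A 1 0 * v 0 + (l - A 0 0) * v 1 := rfl
  refine exists_isLinearOrder_of_injective_addMonoidHom f ?_ A.mulVec (l := l) (by linarith) ?_
  · refine (injective_iff_map_eq_zero f).2 fun v hv => ?_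
    rw [hf] at hv
    have h1 : v 1 = 0 := by
      by_contra h
      refine (hirr.mul_intCast h).ne_int (A 0 0 * v 1 - A 1 1 * v 1 - 2 * A 1 0 * v 0) ?_
      push_cast
      rw [hl] at hv
      linear_combination 2 * hv
    have h0 : v 0 = 0 := by
      simpa [h1, hc] using hv
    ext i
    fin_cases i
    exacts [h0, h1]
  · intro v
    simp only [hf, Matrix.mulVec, dotProduct, Fin.sum_univ_two, Int.cast_add, Int.cast_mul]
    linear_combination (-(v 1 : ℝ)) * hchar - v 1 * hdetR
end

section
/- Let N be a group equipped with a linear order that is invariant under left multiplication (b ≤ c implies ab ≤ ac), and let φ be an automorphism of N that preserves the order (a ≤ b implies φ(a) ≤ φ(b)). Let G = N ⋊_φ ℤ be the semidirect product in which 1 ∈ ℤ acts by φ, so that (a,m)(b,n) = (a·φ^m(b), m+n), and let x = (1_N, 1) ∈ G. Then there exists a linear order on the set G/⟨x⟩ of left cosets of ⟨x⟩ that is invariant under the G-action by left multiplication: for every g ∈ G and all cosets a ≤ b, g·a ≤ g·b. -/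
namespace SemidirectProduct

variable {N G : Type*} [Group N] [Group G] {φ : G →* MulAut N}

theorem inv_mul_mem_range_inr_iff {a b : N ⋊[φ] G} :
    a⁻¹ * b ∈ (inr : G →* N ⋊[φ] G).range ↔ a.left = b.left := by
  constructor
  · rintro ⟨g, hg⟩
    rw [eq_inv_mul_iff_mul_eq] at hg
    simp [← hg]
  · intro h
    exact ⟨a.right⁻¹ * b.right, by ext <;> simp [h]⟩

/-- The left cosets of the complement `G` in `N ⋊[φ] G` are represented uniquely by elements
of `N`. -/
def cosetLeft {H : Subgroup (N ⋊[φ] G)} (hH : H = inr.range) : (N ⋊[φ] G) ⧸ H → N :=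
  Quotient.lift left fun a b hab => by
    rw [← Quotient.eq_iff_equiv] at hab
    have h := QuotientGroup.eq.mp hab
    rwa [hH, inv_mul_mem_range_inr_iff] at h

theorem cosetLeft_injective {H : Subgroup (N ⋊[φ] G)} (hH : H = inr.range) :
    Function.Injective (cosetLeft hH) := by
  intro p q
  induction p using QuotientGroup.induction_on
  induction q using QuotientGroup.induction_on
  intro h
  rw [QuotientGroup.eq, hH]
  exact inv_mul_mem_range_inr_iff.mpr h

theorem cosetLeft_smul {H : Subgroup (N ⋊[φ] G)} (hH : H = inr.range) (g : N ⋊[φ] G)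
    (q : (N ⋊[φ] G) ⧸ H) : cosetLeft hH (g • q) = g.left * φ g.right (cosetLeft hH q) := by
  induction q using QuotientGroup.induction_on
  rfl

theorem zpowers_inr_ofAdd_one (φ : Multiplicative ℤ →* MulAut N) :
    Subgroup.zpowers (inr (Multiplicative.ofAdd (1 : ℤ)) : N ⋊[φ] Multiplicative ℤ) =
      inr.range := by
  rw [← MonoidHom.map_zpowers, MonoidHom.range_eq_map]
  congr 1
  refine (Subgroup.eq_top_iff' _).mpr fun n => ⟨n.toAdd, ?_⟩
  simp [← ofAdd_zsmul]

end SemidirectProduct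

theorem MulAut.monotone_zpow {N : Type*} [Group N] [LinearOrder N] {φ : MulAut N}
    (hφ : Monotone φ) (n : ℤ) : Monotone (φ ^ n) := by
  have hinv : Monotone (φ⁻¹ : MulAut N) := fun a b hab => by
    rw [← (hφ.strictMono_of_injective φ.injective).le_iff_le]
    simpa using hab
  induction n with
  | zero => simpa using monotone_id
  | succ n ih =>
    rw [zpow_add_one]
    exact ih.comp hφ
  | pred n ih =>
    rw [zpow_sub_one]
    exact ih.comp hinv

/-- Let `N` be a group equipped with a linear order invariant under left
multiplication, and let `φ` be an order-preserving automorphism of `N`.  Let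
`G = N ⋊_φ ℤ` be the semidirect product in which `1 ∈ ℤ` acts by `φ`, so that
`(a, m) * (b, n) = (a · φ^m(b), m + n)`, and let `x = (1, 1) ∈ G`.  Then there exists a linear
order on the set `G/⟨x⟩` of left cosets of `⟨x⟩` invariant under the `G`-action by left
multiplication. -/
theorem exists_invariant_linear_order_on_cosets_of_mapping_torus
    {N : Type*} [Group N] [LinearOrder N]
    (hmul : ∀ a b c : N, b ≤ c → a * b ≤ a * c)
    (φ : N ≃* N) (hφ : ∀ a b : N, a ≤ b → φ a ≤ φ b) :
    ∃ r : ((N ⋊[zpowersHom (MulAut N) φ] Multiplicative ℤ) ⧸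
            Subgroup.zpowers
              (SemidirectProduct.inr (Multiplicative.ofAdd (1 : ℤ)) :
                N ⋊[zpowersHom (MulAut N) φ] Multiplicative ℤ)) →
          ((N ⋊[zpowersHom (MulAut N) φ] Multiplicative ℤ) ⧸
            Subgroup.zpowers
              (SemidirectProduct.inr (Multiplicative.ofAdd (1 : ℤ)) :
                N ⋊[zpowersHom (MulAut N) φ] Multiplicative ℤ)) → Prop,
      IsLinearOrder _ r ∧
        ∀ (g : N ⋊[zpowersHom (MulAut N) φ] Multiplicative ℤ) a b, r a b → r (g • a) (g • b) := by
  have hH := SemidirectProduct.zpowers_inr_ofAdd_one (zpowersHom (MulAut N) φ)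
  refine ⟨fun p q => SemidirectProduct.cosetLeft hH p ≤ SemidirectProduct.cosetLeft hH q,
    { refl := fun _ => le_rfl
      trans := fun _ _ _ => le_trans
      antisymm := fun _ _ h₁ h₂ => SemidirectProduct.cosetLeft_injective hH (le_antisymm h₁ h₂)
      total := fun _ _ => le_total _ _ }, fun g a b hab => ?_⟩
  simp only [SemidirectProduct.cosetLeft_smul]
  exact hmul _ _ _ (MulAut.monotone_zpow hφ g.right.toAdd hab)
end
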